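/- arXiv:2309.04066 — 5 statements merged into one kernel-verified Lean document; each statement's English description precedes it below -/
import Mathlib

section
/- Let F be a real quadratic field with class number 1, let p ≥ 7 be a prime with p ≡ 3 (mod 4) that is inert in O_F, and let K = F(√−p). Then the unit groups coincide: O_K^× = O_F^× (every unit of the ring of integers of K lies in the ring of integers of F). In particular one may choose the fundamental unit of K to equal the totally positive fundamental unit ε_F of F. -/
open NumberField IntermediateField

lemma aux_real (d : ℕ) (F : IntermediateField ℚ ℂ)
    (hF : F = ℚ⟮((Real.sqrt d : ℝ) : ℂ)⟯) (φ : F →+* ℂ) (y : F) :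
    (starRingEnd ℂ) (φ y) = φ y := by
  subst hF
  have h2 : ((Real.sqrt d : ℝ) : ℂ) * ((Real.sqrt d : ℝ) : ℂ) = d := by
    norm_cast; simp
  have hg := congrArg φ (Subtype.ext h2 :
    (AdjoinSimple.gen ℚ ((Real.sqrt d : ℝ) : ℂ)) * AdjoinSimple.gen ℚ ((Real.sqrt d : ℝ) : ℂ)
      = (d : ℚ⟮((Real.sqrt d : ℝ) : ℂ)⟯))
  rw [map_mul, map_natCast] at hg
  have hreal : (starRingEnd ℂ) (φ (AdjoinSimple.gen ℚ ((Real.sqrt d : ℝ) : ℂ)))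
      = φ (AdjoinSimple.gen ℚ ((Real.sqrt d : ℝ) : ℂ)) := by
    rw [← h2] at hg
    rcases mul_self_eq_mul_self_iff.1 hg with h | h <;> rw [h] <;> simp
  have : ((starRingEnd ℂ).comp φ).toRatAlgHom = φ.toRatAlgHom := by
    apply IntermediateField.algHom_ext_of_eq_adjoin _ (s := {((Real.sqrt d : ℝ) : ℂ)}) rfl
    rintro x hx
    obtain rfl := hx
    exact hreal
  exact DFunLike.congr_fun this y

lemma aux_decomp (d p : ℕ) (F K : IntermediateField ℚ ℂ)
    (hF : F = ℚ⟮((Real.sqrt d : ℝ) : ℂ)⟯)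
    (hK : K = IntermediateField.adjoin ℚ
      {((Real.sqrt d : ℝ) : ℂ), Complex.I * ((Real.sqrt p : ℝ) : ℂ)})
    (x : ℂ) (hx : x ∈ K) :
    ∃ a ∈ F, ∃ b ∈ F, x = a + b * (Complex.I * ((Real.sqrt p : ℝ) : ℂ)) := by
  have hs : (Complex.I * ((Real.sqrt p : ℝ) : ℂ)) * (Complex.I * ((Real.sqrt p : ℝ) : ℂ)) = -p := by
    have h2 : ((Real.sqrt p : ℝ) : ℂ) * ((Real.sqrt p : ℝ) : ℂ) = p := by
      norm_cast; simp
    linear_combination ((Real.sqrt p : ℝ) : ℂ) * ((Real.sqrt p : ℝ) : ℂ) * Complex.I_mul_I - h2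
  have hreal : ∀ y ∈ F, (starRingEnd ℂ) y = y := fun y hy =>
    aux_real d F hF F.val.toRingHom ⟨y, hy⟩
  have hpF : (p : ℂ) ∈ F := _root_.natCast_mem F p
  subst hK
  induction hx using IntermediateField.adjoin_induction with
  | mem x hx =>
    rcases hx with rfl | rfl
    · exact ⟨_, hF ▸ mem_adjoin_simple_self ℚ _, 0, zero_mem _, by simp⟩
    · exact ⟨0, zero_mem _, 1, one_mem _, by simp⟩
  | algebraMap q => exact ⟨_, IntermediateField.algebraMap_mem F q, 0, zero_mem _, by simp⟩
  | add x y _ _ h1 h2 =>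
    obtain ⟨a, ha, b, hb, rfl⟩ := h1
    obtain ⟨a', ha', b', hb', rfl⟩ := h2
    exact ⟨a + a', add_mem ha ha', b + b', add_mem hb hb', by ring⟩
  | mul x y _ _ h1 h2 =>
    obtain ⟨a, ha, b, hb, rfl⟩ := h1
    obtain ⟨a', ha', b', hb', rfl⟩ := h2
    refine ⟨a * a' - p * (b * b'), sub_mem (mul_mem ha ha') (mul_mem hpF (mul_mem hb hb')),
      a * b' + b * a', add_mem (mul_mem ha hb') (mul_mem hb ha'), ?_⟩
    linear_combination (b * b') * hs
  | inv x _ h1 =>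
    obtain ⟨a, ha, b, hb, rfl⟩ := h1
    set s := Complex.I * ((Real.sqrt p : ℝ) : ℂ) with hsd
    by_cases h0 : a + b * s = 0
    · exact ⟨0, zero_mem _, 0, zero_mem _, by simp [h0]⟩
    have hc : (starRingEnd ℂ) (a + b * s) = a - b * s := by
      rw [map_add, map_mul, hreal a ha, hreal b hb, hsd]; simp [sub_eq_add_neg]
    have h1 : a - b * s ≠ 0 := by
      rw [← hc]; exact (map_ne_zero (starRingEnd ℂ)).2 h0
    have hN : (a + b * s) * (a - b * s) = a * a + p * (b * b) := by
      linear_combination (-b * b) * hs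
    have hNF : a * a + p * (b * b) ∈ F := add_mem (mul_mem ha ha) (mul_mem hpF (mul_mem hb hb))
    refine ⟨a * (a * a + p * (b * b))⁻¹, mul_mem ha (inv_mem hNF),
      (-b) * (a * a + p * (b * b))⁻¹, mul_mem (neg_mem hb) (inv_mem hNF), ?_⟩
    rw [← hN]
    field_simp
    ring

lemma aux_int (p : ℕ) (F : IntermediateField ℚ ℂ) (hp0 : p ≠ 0)
    (hinert : (Ideal.span {(p : 𝓞 F)}).IsPrime) (y : ℂ) (hy : y ∈ F)
    (h : IsIntegral ℤ ((p : ℂ) * y ^ 2)) : IsIntegral ℤ y := by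
  have hpF : (p : ℂ) ∈ F := _root_.natCast_mem F p
  have hpi : IsIntegral ℤ (p : ℂ) := isIntegral_natCast p
  have key : ∀ z : F, IsIntegral ℤ (z : ℂ) → IsIntegral ℤ z := fun z hz =>
    (isIntegral_algHom_iff (F.val.restrictScalars ℤ) F.val.injective).1 hz
  have hz : IsIntegral ℤ ((p : ℂ) * y) := by
    apply IsIntegral.of_pow (n := 2) (by norm_num)
    have : ((p : ℂ) * y) ^ 2 = p * (p * y ^ 2) := by ring
    rw [this]; exact hpi.mul h
  let Z : 𝓞 F := ⟨⟨(p : ℂ) * y, mul_mem hpF hy⟩, key _ hz⟩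
  let W : 𝓞 F := ⟨⟨(p : ℂ) * y ^ 2, mul_mem hpF (pow_mem hy 2)⟩, key _ h⟩
  have hZW : Z ^ 2 = p * W := by
    apply RingOfIntegers.ext
    apply Subtype.ext
    change ((p : ℂ) * y) ^ 2 = ((p : 𝓞 F) : F) * (p * y ^ 2)
    simp; ring
  have hZ : Z ∈ Ideal.span {(p : 𝓞 F)} := by
    apply hinert.mem_of_pow_mem 2
    rw [hZW]; exact Ideal.mem_span_singleton.2 (dvd_mul_right _ _)
  obtain ⟨V, hV⟩ := Ideal.mem_span_singleton.1 hZ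
  have hV' : (p : ℂ) * y = p * ((V : F) : ℂ) := by
    have := congrArg (fun z : 𝓞 F => ((z : F) : ℂ)) hV
    change (p : ℂ) * y = (((p : 𝓞 F) * V : 𝓞 F) : F) at this
    rw [this]; simp
  have := mul_left_cancel₀ (Nat.cast_ne_zero.2 hp0) hV'
  rw [this]
  exact (V.isIntegral_coe).map (F.val.restrictScalars ℤ)

lemma aux_zero (d p : ℕ) (F : IntermediateField ℚ ℂ) [NumberField F]
    (hF : F = ℚ⟮((Real.sqrt d : ℝ) : ℂ)⟯) (hp : 7 ≤ p) (t g : F) (hg : IsIntegral ℤ g)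
    (h : t ^ 2 + p * g ^ 2 = 4) : g = 0 := by
  by_contra hne
  have hlt : ∀ w : InfinitePlace F, w g < 1 := by
    intro w
    rw [← InfinitePlace.norm_embedding_eq w g]
    have ht := aux_real d F hF w.embedding t
    have hg := aux_real d F hF w.embedding g
    obtain ⟨t', ht'⟩ := Complex.conj_eq_iff_real.1 ht
    obtain ⟨g', hg'⟩ := Complex.conj_eq_iff_real.1 hg
    have he := congrArg w.embedding h
    simp only [map_add, map_mul, map_pow, map_natCast, map_ofNat, ht', hg'] at he
    have he' : t' ^ 2 + p * g' ^ 2 = 4 := by exact_mod_cast he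
    rw [hg', Complex.norm_real, Real.norm_eq_abs, ← sq_lt_one_iff_abs_lt_one]
    have : (7 : ℝ) ≤ p := by exact_mod_cast hp
    nlinarith [sq_nonneg t', sq_nonneg g', mul_le_mul_of_nonneg_right this (sq_nonneg g')]
  obtain ⟨w⟩ : Nonempty (InfinitePlace F) := inferInstance
  have := InfinitePlace.one_le_of_lt_one (w := w) (a := (⟨g, hg⟩ : 𝓞 F))
    (fun h0 => hne (congrArg (fun z : 𝓞 F => (z : F)) h0)) (fun {z} _ => hlt z)
  exact absurd (hlt w) (not_lt.2 this)

/-- Let `F = ℚ(√d)` be a real quadratic field with class number one, let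
`p ≥ 7` be a prime with `p ≡ 3 (mod 4)` that is inert in `O_F`, and let `K = F(√-p)`.
Then `O_K^× = O_F^×`: an element of `ℂ` is a unit of the ring of integers of `K`
(i.e. lies in `K` and both it and its inverse are algebraic integers) if and only if it
is a unit of the ring of integers of `F`. -/
theorem unitGroup_of_K_eq_unitGroup_of_F
    (d p : ℕ) (hd1 : 1 < d) (hdsq : Squarefree d)
    (F K : IntermediateField ℚ ℂ) [NumberField F] [NumberField K]
    (hF : F = ℚ⟮((Real.sqrt d : ℝ) : ℂ)⟯)
    (hFK : F ≤ K)
    (hK : K = IntermediateField.adjoin ℚ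
      {((Real.sqrt d : ℝ) : ℂ), Complex.I * ((Real.sqrt p : ℝ) : ℂ)})
    (hhF : NumberField.classNumber F = 1)
    [Fact p.Prime] (hp7 : 7 ≤ p) (hp4 : p % 4 = 3)
    (hinert : (Ideal.span {(p : 𝓞 F)}).IsPrime) :
    ∀ x : ℂ, (x ∈ K ∧ IsIntegral ℤ x ∧ IsIntegral ℤ x⁻¹) ↔
      (x ∈ F ∧ IsIntegral ℤ x ∧ IsIntegral ℤ x⁻¹) := by
  intro x
  refine ⟨?_, fun h => ⟨hFK h.1, h.2⟩⟩
  rintro ⟨hxK, hx, hxi⟩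
  refine ⟨?_, hx, hxi⟩
  obtain ⟨a, ha, b, hb, hxab⟩ := aux_decomp d p F K hF hK x hxK
  by_cases hx0 : x = 0
  · rw [hx0]; exact zero_mem _
  have hp0 : p ≠ 0 := by omega
  have hpC : (p : ℂ) ≠ 0 := Nat.cast_ne_zero.2 hp0
  have hpF : (p : ℂ) ∈ F := _root_.natCast_mem F p
  have hs : (Complex.I * ((Real.sqrt p : ℝ) : ℂ)) * (Complex.I * ((Real.sqrt p : ℝ) : ℂ)) = -p := by
    have h2 : ((Real.sqrt p : ℝ) : ℂ) * ((Real.sqrt p : ℝ) : ℂ) = p := by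
      norm_cast; simp
    linear_combination ((Real.sqrt p : ℝ) : ℂ) * ((Real.sqrt p : ℝ) : ℂ) * Complex.I_mul_I - h2
  have hreal : ∀ y ∈ F, (starRingEnd ℂ) y = y := fun y hy =>
    aux_real d F hF F.val.toRingHom ⟨y, hy⟩
  have hc : (starRingEnd ℂ) x = a - b * (Complex.I * ((Real.sqrt p : ℝ) : ℂ)) := by
    rw [hxab, map_add, map_mul, hreal a ha, hreal b hb]; simp [sub_eq_add_neg]
  have hconj : ∀ y : ℂ, IsIntegral ℤ y → IsIntegral ℤ ((starRingEnd ℂ) y) := fun y hy =>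
    hy.map (Complex.conjAe.toAlgHom.restrictScalars ℤ)
  have hx' := hconj _ hx
  have hxi' := hconj _ hxi
  rw [map_inv₀] at hxi'
  have hx'0 : (starRingEnd ℂ) x ≠ 0 := by simpa using hx0
  generalize (starRingEnd ℂ) x = x' at *
  generalize Complex.I * ((Real.sqrt p : ℝ) : ℂ) = s at *
  have hN : x * x' = a * a + p * (b * b) := by
    rw [hxab, hc]; linear_combination (-b * b) * hs
  have hN0 : a * a + p * (b * b) ≠ 0 := hN ▸ mul_ne_zero hx0 hx'0
  have hNF : a * a + p * (b * b) ∈ F := add_mem (mul_mem ha ha) (mul_mem hpF (mul_mem hb hb))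
  have h2F : (2 : ℂ) ∈ F := ofNat_mem F 2
  have h4F : (4 : ℂ) ∈ F := ofNat_mem F 4
  let t : F := ⟨2 * (a * a - p * (b * b)) * (a * a + p * (b * b))⁻¹,
    mul_mem (mul_mem h2F (sub_mem (mul_mem ha ha) (mul_mem hpF (mul_mem hb hb)))) (inv_mem hNF)⟩
  let g : F := ⟨4 * (a * b) * (a * a + p * (b * b))⁻¹,
    mul_mem (mul_mem h4F (mul_mem ha hb)) (inv_mem hNF)⟩
  have htint : IsIntegral ℤ (t : ℂ) := by
    have : (t : ℂ) = x * x'⁻¹ + x' * x⁻¹ := by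
      have e : x * x'⁻¹ + x' * x⁻¹ = (x * x + x' * x') * (x * x')⁻¹ := by field_simp
      rw [e, hN]
      change 2 * (a * a - p * (b * b)) * (a * a + p * (b * b))⁻¹ = _
      congr 1
      rw [hxab, hc]; linear_combination (-2 * b * b) * hs
    rw [this]; exact (hx.mul hxi').add (hx'.mul hxi)
  have heq : (t : ℂ) ^ 2 + p * (g : ℂ) ^ 2 = 4 := by
    change (2 * (a * a - p * (b * b)) * (a * a + p * (b * b))⁻¹) ^ 2 +
      p * (4 * (a * b) * (a * a + p * (b * b))⁻¹) ^ 2 = 4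
    have hi := mul_inv_cancel₀ hN0
    generalize (a * a + p * (b * b))⁻¹ = n at *
    linear_combination 4 * ((a * a + p * (b * b)) * n + 1) * hi
  have h4i : IsIntegral ℤ (4 : ℂ) := by
    simpa using (isIntegral_natCast 4 : IsIntegral ℤ ((4 : ℕ) : ℂ))
  have hgint : IsIntegral ℤ (g : ℂ) := by
    apply aux_int p F hp0 hinert _ g.2
    have : (p : ℂ) * (g : ℂ) ^ 2 = 4 - (t : ℂ) ^ 2 := by linear_combination heq
    rw [this]
    exact h4i.sub (htint.pow 2)
  have hgz : g = 0 := by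
    apply aux_zero d p F hF hp7 t g
    · exact (isIntegral_algHom_iff (F.val.restrictScalars ℤ) F.val.injective).1 hgint
    · apply Subtype.ext
      exact heq
  have hgz' : 4 * (a * b) * (a * a + p * (b * b))⁻¹ = 0 := congrArg (fun z : F => (z : ℂ)) hgz
  have hab : a = 0 ∨ b = 0 := by simpa [inv_eq_zero, hN0] using hgz'
  rcases hab with h0 | h0
  · exfalso
    rw [h0] at hxab
    have hxx : x ^ 2 = -(p * b ^ 2) := by
      rw [hxab]; linear_combination b ^ 2 * hs
    have hbint : IsIntegral ℤ b := by
      apply aux_int p F hp0 hinert _ hb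
      have : (p : ℂ) * b ^ 2 = - x ^ 2 := by rw [hxx]; ring
      rw [this]; exact (hx.pow 2).neg
    have hinv : IsIntegral ℤ ((p : ℂ)⁻¹) := by
      have : (p : ℂ)⁻¹ = -(b ^ 2 * x⁻¹ ^ 2) := by
        field_simp
        linear_combination hxx
      rw [this]; exact ((hbint.pow 2).mul (hxi.pow 2)).neg
    let P : 𝓞 F := ⟨⟨(p : ℂ)⁻¹, inv_mem hpF⟩,
      (isIntegral_algHom_iff (F.val.restrictScalars ℤ) F.val.injective).1 hinv⟩
    have hP : (p : 𝓞 F) * P = 1 := by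
      apply RingOfIntegers.ext
      apply Subtype.ext
      change (((p : 𝓞 F) : F) : ℂ) * (p : ℂ)⁻¹ = 1
      simp [hpC]
    apply hinert.ne_top
    rw [Ideal.span_singleton_eq_top]
    exact IsUnit.of_mul_eq_one _ hP
  · rw [hxab, h0]; simpa using ha
end

section
/- Let F be a real quadratic field with class number 1, let p ≥ 7 be a prime with p ≡ 3 (mod 4) that is inert in O_F, and let K = F(√−p). Then the regulators satisfy R_K = 2·R_F, where R_F and R_K denote the regulators of F and K respectively. -/
open NumberField IntermediateField

theorem aux_reg_equiv {L K : Type*} [Field L] [Field K] [NumberField L] [NumberField K]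
    (f : L ≃+* K) : Units.regulator L = Units.regulator K := by
  classical
  let E : InfinitePlace K ≃ InfinitePlace L :=
    { toFun := fun w => w.comap (f : L →+* K)
      invFun := fun w => w.comap (f.symm : K →+* L)
      left_inv := fun w => by ext x; simp [InfinitePlace.comap_apply]
      right_inv := fun w => by ext x; simp [InfinitePlace.comap_apply] }
  have hE : ∀ w x, E w x = w (f x) := fun w x => rfl
  have hm : ∀ w, (E w).mult = w.mult := by
    intro w
    have : (E w).IsReal ↔ w.IsReal := InfinitePlace.isReal_comap_iff f
    simp only [InfinitePlace.mult, this]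
  have hr : Units.rank K = Units.rank L := by
    simp only [Units.rank, Fintype.card_congr E]
  let g : (𝓞 L)ˣ ≃* (𝓞 K)ˣ := Units.mapEquiv (RingOfIntegers.mapRingEquiv f).toMulEquiv
  have hg : ∀ u : (𝓞 L)ˣ, ((g u : 𝓞 K) : K) = f ((u : 𝓞 L) : L) := fun u => rfl
  let v : Fin (Units.rank K) → (𝓞 K)ˣ := fun i => g (Units.fundSystem L (finCongr hr i))
  have h1 : Units.regOfFamily v = Units.regulator L := by
    let w₀ : InfinitePlace L := Units.dirichletUnitTheorem.w₀
    let e : {w // w ≠ E.symm w₀} ≃ {w // w ≠ w₀} :=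
      E.subtypeEquiv fun w ↦ by rw [not_iff_not, Equiv.eq_symm_apply]
    have he : ∀ w, (e w).1 = E w.1 := fun w => rfl
    let e2 : {w : InfinitePlace L // w ≠ w₀} ≃ Fin (Units.rank L) := (Units.equivFinRank L).symm
    rw [Units.regulator_eq_regOfFamily_fundSystem, Units.regOfFamily_eq_det _ w₀ e2,
      Units.regOfFamily_eq_det _ (E.symm w₀) (e.trans (e2.trans (finCongr hr.symm))),
      ← Matrix.det_reindex_self e]
    congr 2
    ext i w
    obtain ⟨w, rfl⟩ := e.surjective w
    simp [v, he, hm, hg, hE]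
  have h2 := Units.regOfFamily_div_regulator v
  have h3 : Subgroup.closure (Set.range v) ⊔ Units.torsion K = ⊤ := by
    rw [eq_top_iff]
    have ht : Subgroup.map g.toMonoidHom (Units.torsion L) ≤ Units.torsion K := by
      rintro _ ⟨x, hx, rfl⟩
      exact MonoidHom.isOfFinOrder _ hx
    have h4 : Subgroup.map g.toMonoidHom ⊤ = ⊤ :=
      Subgroup.map_top_of_surjective _ g.surjective
    rw [← h4, ← Units.closure_fundSystem_sup_torsion_eq_top, Subgroup.map_sup]
    refine sup_le_sup ?_ ht
    rw [MonoidHom.map_closure]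
    apply Subgroup.closure_mono
    rintro _ ⟨_, ⟨i, rfl⟩, rfl⟩
    exact ⟨finCongr hr.symm i, by simp [v]⟩
  rw [h3, h1, Subgroup.index_top, Nat.cast_one, div_eq_one_iff_eq (Units.regulator_ne_zero K)] at h2
  exact h2

theorem aux_no_sq {R : Type*} [CommRing R] [IsDomain R] (p : R) (hp : Prime p) (v e : R)
    (he : IsUnit e) (h : v ^ 2 = p * e) : False := by
  have h1 : p ∣ v := hp.dvd_of_dvd_pow (n := 2) (h ▸ dvd_mul_right _ _)
  obtain ⟨c, rfl⟩ := h1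
  have : p * (c ^ 2) = e := mul_left_cancel₀ hp.ne_zero (by linear_combination h)
  exact hp.not_isUnit (isUnit_of_dvd_unit ⟨_, this.symm⟩ he)

theorem aux_conj {K : Type*} [Field K] [NumberField K] [IsCMField K] (p : ℕ) (hp0 : 0 < p)
    (s : K) (hs : s ^ 2 = -(p : K)) : IsCMField.complexConj K s = -s := by
  have h1 : (IsCMField.complexConj K s) ^ 2 = s ^ 2 := by
    rw [← map_pow, hs]; simp
  rcases sq_eq_sq_iff_eq_or_eq_neg.mp h1 with h | h
  · exfalso
    rw [IsCMField.complexConj_eq_self_iff, mem_maximalRealSubfield_iff] at h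
    let φ : K →+* ℂ := Classical.choice (inferInstance : Nonempty _)
    have h2 := h φ
    have h3 : (φ s) ^ 2 = -(p : ℂ) := by rw [← map_pow, hs]; simp
    obtain ⟨r, hr⟩ := Complex.conj_eq_iff_real.mp h2
    rw [hr] at h3
    have h4 : r ^ 2 = -(p : ℝ) := by exact_mod_cast h3
    have : (0 : ℝ) < p := by exact_mod_cast hp0
    nlinarith [sq_nonneg r]
  · exact h

theorem aux_no_unit {K : Type*} [Field K] [NumberField K] [IsCMField K] (p : ℕ) (hp0 : 0 < p)
    (hp : Prime (p : 𝓞 (maximalRealSubfield K)))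
    (s : K) (hs : s ^ 2 = -(p : K)) (w : (𝓞 K)ˣ)
    (hw : IsCMField.complexConj K ((w : 𝓞 K) : K) = -((w : 𝓞 K) : K)) : False := by
  have hc := aux_conj p hp0 s hs
  have hsi : IsIntegral ℤ s := by
    refine IsIntegral.of_pow (n := 2) two_pos ?_
    rw [hs]
    exact (isIntegral_natCast (R := ℤ) p).neg
  let S : 𝓞 K := ⟨s, hsi⟩
  have hS : (S : K) = s := rfl
  obtain ⟨v, hv⟩ := (IsCMField.RingOfIntegers.complexConj_eq_self_iff K (S * w)).mp (by
    simp [hw, hS, hc])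
  obtain ⟨e, he⟩ := (IsCMField.Units.complexConj_eq_self_iff K (w ^ 2)).mp (by
    simp [hw])
  refine aux_no_sq _ hp v (-(e : 𝓞 (maximalRealSubfield K))) e.isUnit.neg ?_
  apply FaithfulSMul.algebraMap_injective (𝓞 (maximalRealSubfield K)) K
  simp only [map_pow, hv, map_mul, map_neg, he, map_natCast, hS, mul_pow, hs]
  simp

theorem aux_neg_one (K : Type*) [Field K] [NumberField K] : (-1 : (𝓞 K)ˣ) ∈ Units.torsion K := by
  rw [Units.torsion, CommGroup.mem_torsion]
  exact isOfFinOrder_iff_pow_eq_one.mpr ⟨2, two_pos, by simp⟩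

theorem aux_index {K : Type*} [Field K] [NumberField K] [IsCMField K] (p : ℕ) (hp0 : 0 < p)
    (hp : Prime (p : 𝓞 (maximalRealSubfield K)))
    (s : K) (hs : s ^ 2 = -(p : K)) : IsCMField.indexRealUnits K = 1 := by
  refine (IsCMField.indexRealUnits_eq_one_or_two K).resolve_right fun h => ?_
  obtain ⟨u, hu⟩ := (IsCMField.indexRealUnits_eq_two_iff K).mp h
  set ζ := IsCMField.unitsMulComplexConjInv K u with hζ
  obtain ⟨k, hk⟩ := Subgroup.mem_zpowers_iff.mp
    (hu ▸ Subgroup.mem_top (⟨-1, aux_neg_one K⟩ : Units.torsion K))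
  have hk' : (ζ : (𝓞 K)ˣ) ^ k = -1 := by
    simpa using congrArg Subtype.val hk
  rcases Int.even_or_odd k with ⟨m, hm⟩ | hodd
  · have h1 := IsCMField.complexConj_torsion K (ζ ^ m)
    refine aux_no_unit p hp0 hp s hs ((ζ ^ m : Units.torsion K) : (𝓞 K)ˣ) ?_
    have h2 : (((ζ ^ m : Units.torsion K) : (𝓞 K)ˣ) : 𝓞 K) * (((ζ ^ m : Units.torsion K) : (𝓞 K)ˣ) : 𝓞 K) = -1 := by
      rw [← Units.val_mul, ← Subgroup.coe_mul, ← zpow_add, ← hm, Subgroup.coe_zpow, hk']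
      simp
    have h3 := congrArg (algebraMap (𝓞 K) K) h2
    rw [map_mul, map_neg, map_one] at h3
    rw [h1]
    refine inv_eq_of_mul_eq_one_left ?_
    rw [neg_mul, h3, neg_neg]
  · have h1 : u ^ k = -(IsCMField.unitsComplexConj K (u ^ k)) := by
      have h2 : (ζ : (𝓞 K)ˣ) ^ k = u ^ k * (IsCMField.unitsComplexConj K (u ^ k))⁻¹ := by
        rw [hζ, IsCMField.unitsMulComplexConjInv_apply, mul_zpow, inv_zpow, map_zpow]
      rw [hk', eq_mul_inv_iff_mul_eq] at h2
      rw [neg_one_mul] at h2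
      exact h2.symm
    refine aux_no_unit p hp0 hp s hs (u ^ k) ?_
    have h3 := congrArg (fun x : (𝓞 K)ˣ => -((x : 𝓞 K) : K)) h1
    simp only [Units.val_neg, map_neg, neg_neg] at h3
    rw [h3]
    rfl

theorem aux_finrank {k L : Type*} [Field k] [Field L] [Algebra k L] (s : L) (a : k)
    (hs : s ^ 2 = algebraMap k L a) (ha : ∀ r : k, r ^ 2 ≠ a) (htop : k⟮s⟯ = ⊤) :
    Module.finrank k L = 2 := by
  have hmon : (Polynomial.X ^ 2 - Polynomial.C a).Monic := Polynomial.monic_X_pow_sub_C a two_ne_zero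
  have hdeg : (Polynomial.X ^ 2 - Polynomial.C a).natDegree = 2 := Polynomial.natDegree_X_pow_sub_C
  have hirr : Irreducible (Polynomial.X ^ 2 - Polynomial.C a) := by
    refine Polynomial.irreducible_of_degree_le_three_of_not_isRoot (by simp [hdeg]) fun x hx => ?_
    refine ha x ?_
    simpa [sub_eq_zero] using hx
  have hmp := minpoly.eq_of_irreducible_of_monic hirr (x := s) (by simp [hs]) hmon
  have hint : IsIntegral k s := ⟨_, hmon, by simp [hs]⟩
  rw [← IntermediateField.finrank_top', ← htop, IntermediateField.adjoin.finrank hint, ← hmp, hdeg]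

theorem regulator_K_eq_two_mul_regulator_F
    (d p : ℕ) (hd1 : 1 < d) (hdsq : Squarefree d)
    (F K : IntermediateField ℚ ℂ) [NumberField F] [NumberField K]
    (hF : F = ℚ⟮((Real.sqrt d : ℝ) : ℂ)⟯)
    (hFK : F ≤ K)
    (hK : K = IntermediateField.adjoin ℚ
      {((Real.sqrt d : ℝ) : ℂ), Complex.I * ((Real.sqrt p : ℝ) : ℂ)})
    (hhF : NumberField.classNumber F = 1)
    [Fact p.Prime] (hp7 : 7 ≤ p) (hp4 : p % 4 = 3)
    (hinert : (Ideal.span {(p : 𝓞 F)}).IsPrime) :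
    NumberField.Units.regulator K = 2 * NumberField.Units.regulator F := by
  have hp0 : 0 < p := by omega
  have hpR : (0 : ℝ) < p := by exact_mod_cast hp0
  have hsd : ((Real.sqrt d : ℝ) : ℂ) ^ 2 = (d : ℂ) := by
    rw [← Complex.ofReal_pow, Real.sq_sqrt (Nat.cast_nonneg d)]; simp
  have hsp : (Complex.I * ((Real.sqrt p : ℝ) : ℂ)) ^ 2 = -(p : ℂ) := by
    rw [mul_pow, ← Complex.ofReal_pow, Real.sq_sqrt (Nat.cast_nonneg p)]; simp
  have hdF : ((Real.sqrt d : ℝ) : ℂ) ∈ F := hF ▸ IntermediateField.mem_adjoin_simple_self ℚ _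
  have hpK : (Complex.I * ((Real.sqrt p : ℝ) : ℂ)) ∈ K := by
    rw [hK]; exact IntermediateField.subset_adjoin _ _ (by simp)
  let t : F := ⟨_, hdF⟩
  let s : K := ⟨_, hpK⟩
  have ht : t ^ 2 = (d : F) := Subtype.ext (by simpa [t] using hsd)
  have hs : s ^ 2 = -(p : K) := Subtype.ext (by simpa [s] using hsp)
  have htopF : ℚ⟮t⟯ = ⊤ := by
    rw [eq_top_iff]
    rintro ⟨x, hx⟩ -
    suffices ∃ h : x ∈ F, (⟨x, h⟩ : F) ∈ ℚ⟮t⟯ from this.2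
    clear_value s
    have hx' := hx
    rw [hF] at hx'
    induction hx' using IntermediateField.adjoin_induction with
    | mem y hy =>
      rw [Set.mem_singleton_iff] at hy
      subst hy
      exact ⟨hdF, IntermediateField.mem_adjoin_simple_self ℚ t⟩
    | algebraMap q => exact ⟨F.algebraMap_mem q, (ℚ⟮t⟯).algebraMap_mem q⟩
    | add a b _ _ ha hb =>
      obtain ⟨h1, h2⟩ := ha (by rw [hF]; assumption)
      obtain ⟨h3, h4⟩ := hb (by rw [hF]; assumption)
      exact ⟨add_mem h1 h3, add_mem h2 h4⟩
    | mul a b _ _ ha hb =>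
      obtain ⟨h1, h2⟩ := ha (by rw [hF]; assumption)
      obtain ⟨h3, h4⟩ := hb (by rw [hF]; assumption)
      exact ⟨mul_mem h1 h3, mul_mem h2 h4⟩
    | inv a _ ha =>
      obtain ⟨h1, h2⟩ := ha (by rw [hF]; assumption)
      exact ⟨inv_mem h1, inv_mem h2⟩
  letI : Algebra F K := (IntermediateField.inclusion hFK).toRingHom.toAlgebra
  have hmap : ∀ x : F, ((algebraMap F K x : K) : ℂ) = x := fun x => rfl
  have htopK : F⟮s⟯ = ⊤ := by
    rw [eq_top_iff]
    rintro ⟨x, hx⟩ -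
    suffices ∃ h : x ∈ K, (⟨x, h⟩ : K) ∈ F⟮s⟯ from this.2
    have hx' := hx
    rw [hK] at hx'
    induction hx' using IntermediateField.adjoin_induction with
    | mem y hy =>
      rcases hy with rfl | hy
      · exact ⟨hFK hdF, (F⟮s⟯).algebraMap_mem t⟩
      · rw [Set.mem_singleton_iff] at hy
        subst hy
        exact ⟨hpK, IntermediateField.mem_adjoin_simple_self F s⟩
    | algebraMap q =>
      exact ⟨K.algebraMap_mem q, (F⟮s⟯).algebraMap_mem (algebraMap ℚ F q)⟩
    | add a b _ _ ha hb =>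
      obtain ⟨h1, h2⟩ := ha (by rw [hK]; assumption)
      obtain ⟨h3, h4⟩ := hb (by rw [hK]; assumption)
      exact ⟨add_mem h1 h3, add_mem h2 h4⟩
    | mul a b _ _ ha hb =>
      obtain ⟨h1, h2⟩ := ha (by rw [hK]; assumption)
      obtain ⟨h3, h4⟩ := hb (by rw [hK]; assumption)
      exact ⟨mul_mem h1 h3, mul_mem h2 h4⟩
    | inv a _ ha =>
      obtain ⟨h1, h2⟩ := ha (by rw [hK]; assumption)
      exact ⟨inv_mem h1, inv_mem h2⟩
  have hneg : ∀ r : ℂ, star r = r → r ^ 2 ≠ -(p : ℂ) := by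
    intro z hz h
    obtain ⟨r, rfl⟩ := Complex.conj_eq_iff_real.mp hz
    have h4 : r ^ 2 = -(p : ℝ) := by exact_mod_cast h
    nlinarith [sq_nonneg r]
  haveI hreal : IsTotallyReal F := by
    rw [← maximalRealSubfield_eq_top_iff_isTotallyReal, eq_top_iff]
    intro x _
    have hx : x ∈ ℚ⟮t⟯ := htopF ▸ IntermediateField.mem_top
    induction hx using IntermediateField.adjoin_induction with
    | mem y hy =>
      rw [Set.mem_singleton_iff] at hy
      subst hy
      intro φ
      have h1 : (φ t) ^ 2 = ((Real.sqrt d : ℝ) : ℂ) ^ 2 := by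
        rw [← map_pow, ht, hsd]; simp
      rcases sq_eq_sq_iff_eq_or_eq_neg.mp h1 with h | h <;> rw [h] <;> simp
    | algebraMap q => intro φ; simp
    | add a b _ _ ha hb => exact add_mem (ha trivial) (hb trivial)
    | mul a b _ _ ha hb => exact mul_mem (ha trivial) (hb trivial)
    | inv a _ ha => exact inv_mem (ha trivial)
  haveI hcomplex : IsTotallyComplex K := ⟨fun w => by
    rw [← InfinitePlace.not_isReal_iff_isComplex]
    intro h
    rw [InfinitePlace.isReal_iff] at h
    refine hneg (w.embedding s) (RingHom.congr_fun h s) ?_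
    rw [← map_pow, hs]; simp⟩
  have hF2 : Module.finrank ℚ F = 2 := by
    refine aux_finrank t (d : ℚ) (by rw [ht]; simp) (fun r hr => ?_) htopF
    have h1 : IsSquare (d : ℚ) := ⟨r, by rw [← hr, sq]⟩
    rw [Rat.isSquare_natCast_iff] at h1
    obtain ⟨m, hm⟩ := h1
    have := hdsq m ⟨1, by rw [hm, mul_one]⟩
    rw [Nat.isUnit_iff] at this
    subst this
    omega
  have hK2 : Module.finrank F K = 2 := by
    refine aux_finrank s (-(p : F)) (by rw [hs]; simp) (fun r hr => ?_) htopK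
    refine hneg (r : ℂ) (IsTotallyReal.complexEmbedding_isReal (F.val : F →+* ℂ) |> fun h => RingHom.congr_fun h r) ?_
    simpa using congrArg (F.val) hr
  haveI : Algebra.IsQuadraticExtension F K := { finrank_eq_two' := hK2 }
  haveI : IsCMField K := IsCMField.ofCMExtension F K
  let f : F ≃+* maximalRealSubfield K := CMExtension.equivMaximalRealSubfield F K
  have hprimeF : Prime (p : 𝓞 F) :=
    (Ideal.span_singleton_prime (by exact_mod_cast hp0.ne')).mp hinert
  have hprime : Prime (p : 𝓞 (maximalRealSubfield K)) := by
    have := (MulEquiv.prime_iff (RingOfIntegers.mapRingEquiv f)).mpr hprimeF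
    simpa using this
  have hidx := aux_index p hp0 hprime s hs
  have hrank : Units.rank K = 1 := by
    have h1 := IsTotallyReal.finrank (K := F)
    rw [← IsCMField.units_rank_eq_units_rank K, Units.rank,
      InfinitePlace.card_eq_nrRealPlaces_add_nrComplexPlaces,
      IsTotallyReal.nrComplexPlaces_eq_zero, ← IsTotallyReal.finrank,
      ← (f.toRatAlgEquiv).toLinearEquiv.finrank_eq, hF2]
  have h := IsCMField.regulator_div_regulator_eq_two_pow_mul_indexRealUnits_inv K
  rw [hidx, hrank, div_eq_iff (Units.regulator_ne_zero _), ← aux_reg_equiv f] at h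
  simpa using h
end

section
/- Let F, ε_F = s + t·θ_F, and p be as in the context. Then the Shintani set admits the explicit description R_{F,p} = { A/(tp) + (B/(tp))·ε_F : A, B ∈ ℤ, A + s·B ≡ 0 (mod t), 0 < A ≤ tp, 0 ≤ B < tp }. -/
open NumberField IntermediateField

/-- The Shintani set `R_{F,p} = { r₁ + r₂·ε ∈ (1/p)O_F : r₁ ∈ ℚ ∩ (0,1], r₂ ∈ ℚ ∩ [0,1) }`,
viewed as a set of real numbers. -/
def shintaniSet (F : IntermediateField ℚ ℝ) [NumberField F] (p : ℕ) (ε : ℝ) : Set ℝ :=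
  {x | ∃ r₁ r₂ : ℚ, x = (r₁ : ℝ) + (r₂ : ℝ) * ε ∧ 0 < r₁ ∧ r₁ ≤ 1 ∧ 0 ≤ r₂ ∧ r₂ < 1 ∧
    ∃ y : NumberField.RingOfIntegers F, ((y : F) : ℝ) = (p : ℝ) * x}

theorem aux_lin {θ : ℝ} (h : Irrational θ) (a b : ℚ) (e : (a : ℝ) + b * θ = 0) :
    a = 0 ∧ b = 0 := by
  have hb : b = 0 := by
    by_contra hb
    apply h
    refine ⟨-a / b, ?_⟩
    have : (b : ℝ) ≠ 0 := by exact_mod_cast hb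
    push_cast
    field_simp
    linarith
  subst hb
  refine ⟨?_, rfl⟩
  simpa using e

theorem aux_theta (d : ℕ) (hd1 : 1 < d) (hdsq : Squarefree d) (θ : ℝ)
    (hθ : θ = if d % 4 = 1 then (1 + Real.sqrt d) / 2 else Real.sqrt d) :
    Irrational θ ∧ ∃ m n : ℚ, θ ^ 2 = m * θ + n ∧ 0 < 2 * θ - m := by
  have hirr : Irrational (Real.sqrt d) := by
    rw [irrational_sqrt_natCast_iff]
    rintro ⟨n, hn⟩
    have := hdsq n ⟨1, by rw [hn]; ring⟩
    rw [Nat.isUnit_iff] at this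
    subst this
    omega
  have hsq : Real.sqrt d ^ 2 = d := Real.sq_sqrt (by positivity)
  have hpos : 0 < Real.sqrt d := Real.sqrt_pos.mpr (by positivity)
  split_ifs at hθ with h
  · subst hθ
    refine ⟨?_, 1, (d - 1) / 4, ?_, ?_⟩
    · rintro ⟨q, hq⟩
      apply hirr
      refine ⟨2 * q - 1, ?_⟩
      push_cast
      linarith
    · push_cast
      nlinarith
    · push_cast
      linarith
  · subst hθ
    refine ⟨hirr, 0, d, ?_, ?_⟩
    · push_cast
      linarith
    · push_cast
      linarith

theorem aux_pos (θ : ℝ) (h : Irrational θ) (m n : ℚ) (hmn : θ ^ 2 = m * θ + n)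
    (hp : 0 < 2 * θ - m) (ε : ℝ) (s t T : ℤ) (hε : ε = (s : ℝ) + (t : ℝ) * θ) (h1 : 1 < ε)
    (hT : ε ^ 2 - (T : ℝ) * ε + 1 = 0) : 0 < t := by
  have key := aux_lin h (s ^ 2 + t ^ 2 * n - T * s + 1) (2 * s * t + t ^ 2 * m - T * t) (by
    push_cast
    rw [hε] at hT
    linear_combination hT - (t : ℝ) ^ 2 * hmn)
  have ht : t ≠ 0 := by
    rintro rfl
    simp only [Int.cast_zero, zero_mul, add_zero] at hε
    rw [hε] at h1 hT
    have h2 : s * (T - s) = 1 := by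
      have : (s : ℝ) * (T - s) = 1 := by linarith
      exact_mod_cast this
    have h3 : 1 < s := by exact_mod_cast h1
    have := Int.eq_one_or_neg_one_of_mul_eq_one h2
    omega
  have h4 : (T : ℚ) = 2 * s + t * m := by
    have : (t : ℚ) ≠ 0 := by exact_mod_cast ht
    apply mul_left_cancel₀ this
    linarith [key.2]
  have h5 : (T : ℝ) = 2 * s + t * m := by exact_mod_cast h4
  have h6 : ε * (T - ε) = 1 := by linarith
  have h7 : T - ε < 1 := by
    by_contra hc
    push Not at hc
    nlinarith
  have h8 : 0 < (t : ℝ) * (2 * θ - m) := by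
    have : (t : ℝ) * (2 * θ - m) = ε - (T - ε) := by rw [h5, hε]; ring
    rw [this]; linarith
  have := pos_of_mul_pos_left h8 hp.le
  exact_mod_cast this

/-- With `F = ℚ(√d)` of class number one, `O_F = ℤ[θ_F]`,
`ε_F = s + t·θ_F` the totally positive fundamental unit, and `p ≥ 7` a prime with
`p ≡ 3 (mod 4)` and `(d/p) = -1` (so `p` is inert), the Shintani set has the explicit
description `R_{F,p} = { A/(tp) + (B/(tp))·ε_F : A, B ∈ ℤ, t ∣ A + sB, 0 < A ≤ tp,
0 ≤ B < tp }`. -/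
theorem shintani_set_explicit_description
    (d p : ℕ) (hd1 : 1 < d) (hdsq : Squarefree d)
    (F : IntermediateField ℚ ℝ) [NumberField F]
    (hF : F = ℚ⟮(Real.sqrt d)⟯)
    (hhF : NumberField.classNumber F = 1)
    (θ : ℝ) (hθ : θ = if d % 4 = 1 then (1 + Real.sqrt d) / 2 else Real.sqrt d)
    (hOF : ∀ x : ℝ, (∃ y : 𝓞 F, ((y : F) : ℝ) = x) ↔ ∃ a b : ℤ, x = (a : ℝ) + (b : ℝ) * θ)
    [Fact p.Prime] (hp7 : 7 ≤ p) (hp4 : p % 4 = 3)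
    (hleg : legendreSym p (d : ℤ) = -1)
    (hinert : (Ideal.span {(p : 𝓞 F)}).IsPrime)
    (ε : ℝ) (s t : ℤ) (hεst : ε = (s : ℝ) + (t : ℝ) * θ)
    (hεunit : ∃ u : (𝓞 F)ˣ, (((u : 𝓞 F) : F) : ℝ) = ε)
    (hε1 : 1 < ε)
    (hεnorm : ∃ T : ℤ, ε ^ 2 - (T : ℝ) * ε + 1 = 0)
    (hεfund : ∀ x : ℝ, 0 < x → 1 < x →
      (∃ u : (𝓞 F)ˣ, (((u : 𝓞 F) : F) : ℝ) = x) →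
      (∃ T : ℤ, x ^ 2 - (T : ℝ) * x + 1 = 0) → ε ≤ x) :
    shintaniSet F p ε =
      {x : ℝ | ∃ A B : ℤ, t ∣ (A + s * B) ∧ 0 < A ∧ A ≤ t * p ∧ 0 ≤ B ∧ B < t * p ∧
        x = (A : ℝ) / ((t : ℝ) * p) + ((B : ℝ) / ((t : ℝ) * p)) * ε} := by
  obtain ⟨hirr, m, n, hmn, hmp⟩ := aux_theta d hd1 hdsq θ hθ
  obtain ⟨T, hT⟩ := hεnorm
  have ht : 0 < t := aux_pos θ hirr m n hmn hmp ε s t T hεst hε1 hT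
  have hp0 : 0 < p := by omega
  have htR : (0 : ℝ) < t := by exact_mod_cast ht
  have hpR : (0 : ℝ) < p := by exact_mod_cast hp0
  have htQ : (0 : ℚ) < t := by exact_mod_cast ht
  have hpQ : (0 : ℚ) < p := by exact_mod_cast hp0
  have htp : (0 : ℚ) < t * p := by positivity
  ext x
  simp only [shintaniSet, Set.mem_setOf_eq, hOF]
  constructor
  · rintro ⟨r₁, r₂, hx, h1, h2, h3, h4, a, b, hab⟩
    have key := aux_lin hirr (p * r₁ + p * r₂ * s - a) (p * r₂ * t - b) (by
      push_cast
      rw [hx, hεst] at hab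
      linear_combination hab)
    have hB : (b : ℚ) = r₂ * (t * p) := by linarith [key.2]
    have hA : ((t * a - s * b : ℤ) : ℚ) = r₁ * (t * p) := by
      push_cast
      linear_combination (-(t : ℚ)) * key.1 + s * key.2
    refine ⟨t * a - s * b, b, ⟨a, by ring⟩, ?_, ?_, ?_, ?_, ?_⟩
    · have : (0 : ℚ) < ((t * a - s * b : ℤ) : ℚ) := by rw [hA]; positivity
      exact_mod_cast this
    · have : ((t * a - s * b : ℤ) : ℚ) ≤ t * p := by rw [hA]; nlinarith
      exact_mod_cast this
    · have : (0 : ℚ) ≤ b := by rw [hB]; positivity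
      exact_mod_cast this
    · have : (b : ℚ) < t * p := by rw [hB]; nlinarith
      exact_mod_cast this
    · have hA' : ((t * a - s * b : ℤ) : ℝ) = r₁ * (t * p) := by exact_mod_cast hA
      have hB' : (b : ℝ) = r₂ * (t * p) := by exact_mod_cast hB
      rw [hA', hB', hx]
      field_simp
  · rintro ⟨A, B, ⟨c, hc⟩, h1, h2, h3, h4, hx⟩
    have h1' : (0 : ℚ) < A := by exact_mod_cast h1
    have h2' : (A : ℚ) ≤ t * p := by exact_mod_cast h2
    have h3' : (0 : ℚ) ≤ B := by exact_mod_cast h3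
    have h4' : (B : ℚ) < t * p := by exact_mod_cast h4
    refine ⟨A / (t * p), B / (t * p), ?_, by positivity, ?_, by positivity, ?_, c, B, ?_⟩
    · rw [hx]; push_cast; rfl
    · rwa [div_le_one htp]
    · rwa [div_lt_one htp]
    · have hc' : (A : ℝ) + s * B = t * c := by exact_mod_cast hc
      rw [hx, hεst]
      field_simp
      linear_combination hc'
end

section
/- Let F, ε_F, and p be as in the context, and let R_{F,p} be the Shintani set. The map π : R_{F,p} → O_F/pO_F defined by π(r) = p·r + pO_F (note p·r ∈ O_F since r ∈ (1/p)O_F) is surjective, and the quotient O_F/pO_F is a finite field with p² elements. -/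
open NumberField IntermediateField

/-- The map `π : R_{F,p} → O_F/pO_F`, `π(r) = p·r + pO_F`
(note `p·r ∈ O_F` since `r ∈ (1/p)O_F`), is surjective, and `O_F/pO_F` is a finite field
with `p²` elements. -/
theorem shintani_to_quotient_surjective_and_card
    (d p : ℕ) (hd1 : 1 < d) (hdsq : Squarefree d)
    (F : IntermediateField ℚ ℝ) [NumberField F]
    (hF : F = ℚ⟮(Real.sqrt d)⟯)
    (hhF : NumberField.classNumber F = 1)
    (θ : ℝ) (hθ : θ = if d % 4 = 1 then (1 + Real.sqrt d) / 2 else Real.sqrt d)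
    (hOF : ∀ x : ℝ, (∃ y : 𝓞 F, ((y : F) : ℝ) = x) ↔ ∃ a b : ℤ, x = (a : ℝ) + (b : ℝ) * θ)
    [Fact p.Prime] (hp7 : 7 ≤ p) (hp4 : p % 4 = 3)
    (hleg : legendreSym p (d : ℤ) = -1)
    (hinert : (Ideal.span {(p : 𝓞 F)}).IsPrime)
    (ε : ℝ)
    (hεunit : ∃ u : (𝓞 F)ˣ, (((u : 𝓞 F) : F) : ℝ) = ε)
    (hε1 : 1 < ε)
    (hεnorm : ∃ T : ℤ, ε ^ 2 - (T : ℝ) * ε + 1 = 0)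
    (hεfund : ∀ x : ℝ, 0 < x → 1 < x →
      (∃ u : (𝓞 F)ˣ, (((u : 𝓞 F) : F) : ℝ) = x) →
      (∃ T : ℤ, x ^ 2 - (T : ℝ) * x + 1 = 0) → ε ≤ x) :
    (∀ c : 𝓞 F ⧸ Ideal.span {(p : 𝓞 F)}, ∃ x ∈ shintaniSet F p ε, ∃ y : 𝓞 F,
        ((y : F) : ℝ) = (p : ℝ) * x ∧ Ideal.Quotient.mk (Ideal.span {(p : 𝓞 F)}) y = c) ∧
      Nat.card (𝓞 F ⧸ Ideal.span {(p : 𝓞 F)}) = p ^ 2 ∧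
      IsField (𝓞 F ⧸ Ideal.span {(p : 𝓞 F)}) := by
  classical
  have hp : p.Prime := Fact.out
  have hp0 : (0:ℝ) < p := by exact_mod_cast hp.pos
  have hirr : Irrational (Real.sqrt d) := by
    rw [irrational_sqrt_natCast_iff]
    rintro ⟨k, rfl⟩
    have h1 := hdsq k (dvd_refl _)
    rw [Nat.isUnit_iff] at h1
    subst h1
    omega
  have hrank : Module.finrank ℚ F = 2 := by
    have hint : IsIntegral ℚ (Real.sqrt d) := by
      refine ⟨Polynomial.X ^ 2 - Polynomial.C (d : ℚ), Polynomial.monic_X_pow_sub_C _ two_ne_zero, ?_⟩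
      simp
    have h2 : (minpoly ℚ (Real.sqrt d)).natDegree = 2 := by
      apply le_antisymm
      · have hmon : (Polynomial.X ^ 2 - Polynomial.C (d : ℚ)).Monic :=
          Polynomial.monic_X_pow_sub_C _ two_ne_zero
        have := Polynomial.natDegree_le_of_dvd
          (minpoly.dvd ℚ (Real.sqrt d) (p := Polynomial.X ^ 2 - Polynomial.C (d : ℚ)) (by simp)) hmon.ne_zero
        rwa [Polynomial.natDegree_X_pow_sub_C] at this
      · rw [minpoly.two_le_natDegree_iff hint]
        rintro ⟨q, hq⟩
        exact hirr ⟨q, by simpa using hq⟩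
    have := IntermediateField.adjoin.finrank hint
    rw [h2] at this
    rw [hF]
    exact this
  have hcard : Nat.card (𝓞 F ⧸ Ideal.span {(p : 𝓞 F)}) = p ^ 2 := by
    have h1 : Ideal.absNorm (Ideal.span {(p : 𝓞 F)}) = p ^ 2 := by
      rw [Ideal.absNorm_span_singleton]
      have h3 : Algebra.norm ℤ ((p : ℕ) : 𝓞 F) = (p : ℤ) ^ 2 := by
        have := Algebra.norm_algebraMap (S := 𝓞 F) (p : ℤ)
        rw [NumberField.RingOfIntegers.rank, hrank] at this
        simpa using this
      rw [h3]
      simp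
    rw [← h1, Ideal.absNorm_apply]
    rfl
  refine ⟨?_, hcard, ?_⟩
  · intro c
    obtain ⟨y, rfl⟩ := Ideal.Quotient.mk_surjective c
    obtain ⟨u, hu⟩ := hεunit
    obtain ⟨a, b, hab⟩ := (hOF ε).1 ⟨u, hu⟩
    have hb : b ≠ 0 := by
      rintro rfl
      obtain ⟨T, hT⟩ := hεnorm
      have ha : ε = (a : ℝ) := by simpa using hab
      rw [ha] at hT hε1
      have hT' : a ^ 2 - T * a + 1 = 0 := by exact_mod_cast hT
      have ha1 : 1 < a := by exact_mod_cast hε1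
      have hdvd : a ∣ 1 := ⟨T - a, by linarith⟩
      have := Int.le_of_dvd one_pos hdvd
      omega
    have hbR : (b : ℝ) ≠ 0 := by exact_mod_cast hb
    obtain ⟨m, n, hmn⟩ := (hOF ((y : F) : ℝ)).1 ⟨y, rfl⟩
    set s₂ : ℚ := (n : ℚ) / b / p with hs₂
    set s₁ : ℚ := ((m : ℚ) - n * a / b) / p with hs₁
    have hy : ((y : F) : ℝ) = p * ((s₁ : ℝ) + s₂ * ε) := by
      rw [hmn, hab, hs₁, hs₂]
      push_cast
      field_simp
      ring
    have hc1 := Int.ceil_lt_add_one s₁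
    have hc2 := Int.le_ceil s₁
    have hf1 := Int.floor_le s₂
    have hf2 := Int.lt_floor_add_one s₂
    set y' : 𝓞 F := y - p * (((⌈s₁⌉ - 1 : ℤ) : 𝓞 F) + ((⌊s₂⌋ : ℤ) : 𝓞 F) * (u : 𝓞 F)) with hy'
    have key : ((y' : F) : ℝ) =
        (p : ℝ) * (((s₁ - (⌈s₁⌉ - 1) : ℚ) : ℝ) + ((s₂ - ⌊s₂⌋ : ℚ) : ℝ) * ε) := by
      rw [hy']
      push_cast
      have hz : ∀ z : ℤ, (((z : 𝓞 F) : F) : ℝ) = z := fun z => by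
        have h : ((z : 𝓞 F) : F) = (z : F) := map_intCast (algebraMap (𝓞 F) F) z
        rw [h]; rfl
      rw [hy, hu, hz, hz]
      ring
    refine ⟨_, ⟨s₁ - (⌈s₁⌉ - 1), s₂ - ⌊s₂⌋, rfl, by linarith, by linarith, by linarith,
      by linarith, y', key⟩, y', key, ?_⟩
    rw [Ideal.Quotient.eq, Ideal.mem_span_singleton]
    exact ⟨-(((⌈s₁⌉ - 1 : ℤ) : 𝓞 F) + ((⌊s₂⌋ : ℤ) : 𝓞 F) * (u : 𝓞 F)), by rw [hy']; ring⟩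
  · have : Finite (𝓞 F ⧸ Ideal.span {(p : 𝓞 F)}) :=
      Nat.finite_of_card_ne_zero (by rw [hcard]; exact pow_ne_zero _ hp.ne_zero)
    exact Finite.isField_of_domain _
end

section
/- Let F, ε_F, p, the Shintani set R_{F,p}, the action ∗ of ε_F on R_{F,p}, and the map π(r) = p·r + pO_F be as in the context. Then π is equivariant for the action of ⟨ε_F⟩: for every r ∈ R_{F,p}, π(ε_F ∗ r) = (ε_F + pO_F)·π(r) in O_F/pO_F. -/
set_option synthInstance.maxHeartbeats 1000000
set_option maxHeartbeats 1000000

open NumberField IntermediateField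

/-- `(r₁, r₂)` are the coordinates of an element `r₁ + r₂·ε` of the Shintani set
`R_{F,p} = { r₁ + r₂·ε ∈ (1/p)O_F : r₁ ∈ ℚ ∩ (0,1], r₂ ∈ ℚ ∩ [0,1) }`. -/
def inShintani (F : IntermediateField ℚ ℝ) [NumberField F] (p : ℕ) (ε : ℝ)
    (r : ℚ × ℚ) : Prop :=
  0 < r.1 ∧ r.1 ≤ 1 ∧ 0 ≤ r.2 ∧ r.2 < 1 ∧
    ∃ y : NumberField.RingOfIntegers F,
      ((y : F) : ℝ) = (p : ℝ) * ((r.1 : ℝ) + (r.2 : ℝ) * ε)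

/-- In coordinates, the action of `ε` on the Shintani set is
`ε ∗ (r₁ + r₂·ε) = (1 − r₂) + {r₁ + r₂·Tr_{F/ℚ}(ε)}·ε`, where `T = Tr_{F/ℚ}(ε)`. -/
def shintaniAct (T : ℤ) (r : ℚ × ℚ) : ℚ × ℚ :=
  (1 - r.2, Int.fract (r.1 + r.2 * (T : ℚ)))

/-- The map `π : R_{F,p} → O_F/pO_F`, `π(r) = p·r + pO_F`, is
equivariant for the action of `⟨ε_F⟩`: `π(ε_F ∗ r) = (ε_F + pO_F)·π(r)`. -/
theorem shintani_map_equivariant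
    (d p : ℕ) (hd1 : 1 < d) (hdsq : Squarefree d)
    (F : IntermediateField ℚ ℝ) [NumberField F]
    (hF : F = ℚ⟮(Real.sqrt d)⟯)
    (hhF : NumberField.classNumber F = 1)
    (θ : ℝ) (hθ : θ = if d % 4 = 1 then (1 + Real.sqrt d) / 2 else Real.sqrt d)
    (hOF : ∀ x : ℝ, (∃ y : 𝓞 F, ((y : F) : ℝ) = x) ↔ ∃ a b : ℤ, x = (a : ℝ) + (b : ℝ) * θ)
    [Fact p.Prime] (hp7 : 7 ≤ p) (hp4 : p % 4 = 3)
    (hleg : legendreSym p (d : ℤ) = -1)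
    (hinert : (Ideal.span {(p : 𝓞 F)}).IsPrime)
    (ε : ℝ)
    (hεunit : ∃ u : (𝓞 F)ˣ, (((u : 𝓞 F) : F) : ℝ) = ε)
    (hε1 : 1 < ε)
    (Tε : ℤ) (hTε : ε ^ 2 - (Tε : ℝ) * ε + 1 = 0)
    (hεfund : ∀ x : ℝ, 0 < x → 1 < x →
      (∃ u : (𝓞 F)ˣ, (((u : 𝓞 F) : F) : ℝ) = x) →
      (∃ T : ℤ, x ^ 2 - (T : ℝ) * x + 1 = 0) → ε ≤ x) :
    ∀ r : ℚ × ℚ, inShintani F p ε r →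
      ∀ e y y' : 𝓞 F, ((e : F) : ℝ) = ε →
        ((y : F) : ℝ) = (p : ℝ) * ((r.1 : ℝ) + (r.2 : ℝ) * ε) →
        ((y' : F) : ℝ) = (p : ℝ) *
          (((shintaniAct Tε r).1 : ℝ) + ((shintaniAct Tε r).2 : ℝ) * ε) →
        Ideal.Quotient.mk (Ideal.span {(p : 𝓞 F)}) y' =
          Ideal.Quotient.mk (Ideal.span {(p : 𝓞 F)}) e *
            Ideal.Quotient.mk (Ideal.span {(p : 𝓞 F)}) y := by
  intro r _ e y y' he hy hy'
  rw [← map_mul, Ideal.Quotient.eq, Ideal.mem_span_singleton]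
  refine ⟨1 - ((⌊r.1 + r.2 * (Tε : ℚ)⌋ : ℤ) : 𝓞 F) * e, ?_⟩
  apply RingOfIntegers.ext
  apply Subtype.ext
  have hfr : (((Int.fract (r.1 + r.2 * (Tε : ℚ)) : ℚ)) : ℝ)
      = (r.1 : ℝ) + (r.2 : ℝ) * (Tε : ℝ) - ((⌊r.1 + r.2 * (Tε : ℚ)⌋ : ℤ) : ℝ) := by
    rw [← Int.self_sub_floor]
    push_cast
    ring
  simp only [shintaniAct] at hy'
  rw [hfr] at hy'
  push_cast at hy' ⊢
  simp only [map_sub, map_mul, map_one, map_natCast, map_intCast]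
  push_cast
  rw [hy', he, hy]
  linear_combination (-(p : ℝ) * (r.2 : ℝ)) * hTε
end
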